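/- Let A be the symmetric adjacency matrix of the multigraph obtained from the extended 4442 base graph by adding one new vertex x joined to w₂ by a double edge (so the (x,w₂) and (w₂,x) entries of A equal 2). Then A has an eigenvalue strictly larger than √(3+√5): there exist a real number μ > √(3+√5) and a nonzero real vector v with A·v = μ·v. -/

import Mathlib

open Matrix

/-- Extended 4442 base graph; vertex 11 is joined to 9 by a double edge. -/
def edgesDoubleExt4442 : List (Fin 12 × Fin 12) :=
  [(0,1),(1,2),(2,3),(3,4),(4,5),(4,6),(4,7),(5,8),(6,9),(7,10)]

/-- Adjacency matrix of the multigraph: entry is the number of edges between the vertices;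
the pair (9, 11) is joined by a double edge. -/
def adjDoubleExt4442 : Matrix (Fin 12) (Fin 12) ℝ :=
  fun i j =>
    if (i, j) ∈ edgesDoubleExt4442 ∨ (j, i) ∈ edgesDoubleExt4442 then 1
    else if (i, j) = (9, 11) ∨ (i, j) = (11, 9) then 2
    else 0

/-- The equation satisfied by the eigenvalues `m` of `adjDoubleExt4442` that have an eigenvector
of the shape `eigenvectorDoubleExt4442 m`. -/
def charPolyDoubleExt4442 (m : ℝ) : ℝ :=
  m ^ 2 * (m ^ 4 - 3 * m ^ 2 + 1) * (m ^ 2 - 1) * (m ^ 2 - 5)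
    - m ^ 2 * (m ^ 2 - 2) * (m ^ 2 - 1) * (m ^ 2 - 5)
    - 2 * m ^ 2 * (m ^ 4 - 3 * m ^ 2 + 1) * (m ^ 2 - 5)
    - (m ^ 2 - 4) * (m ^ 4 - 3 * m ^ 2 + 1) * (m ^ 2 - 1)

/-- The vector solving the eigenvalue equation of `adjDoubleExt4442` for `m` at every vertex
except possibly the branch vertex `4`. -/
def eigenvectorDoubleExt4442 (m : ℝ) : Fin 12 → ℝ :=
  let k := m * (m ^ 2 - 1) * (m ^ 2 - 5)
  let p := m ^ 4 - 3 * m ^ 2 + 1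
  let c := p * m * (m ^ 2 - 5)
  let d := p * (m ^ 2 - 1)
  ![k, m * k, (m ^ 2 - 1) * k, (m ^ 3 - 2 * m) * k, p * k,
    m * c, (m ^ 2 - 4) * d, m * c, c, m * d, c, 2 * d]

theorem adjDoubleExt4442_mulVec_eigenvector {m : ℝ} (hm : charPolyDoubleExt4442 m = 0) :
    adjDoubleExt4442.mulVec (eigenvectorDoubleExt4442 m) = m • eigenvectorDoubleExt4442 m := by
  unfold charPolyDoubleExt4442 at hm
  ext i
  fin_cases i <;>
    simp [Matrix.mulVec, dotProduct, Fin.sum_univ_succ, adjDoubleExt4442, edgesDoubleExt4442,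
      eigenvectorDoubleExt4442] <;>
    first
    | ring1
    | linear_combination -hm

theorem exists_root_charPolyDoubleExt4442 :
    ∃ m ∈ Set.Icc (2.3 : ℝ) 2.5, charPolyDoubleExt4442 m = 0 := by
  have hcont : ContinuousOn charPolyDoubleExt4442 (Set.Icc 2.3 2.5) := by
    unfold charPolyDoubleExt4442
    fun_prop
  refine intermediate_value_Icc (by norm_num) hcont ⟨?_, ?_⟩ <;>
    norm_num [charPolyDoubleExt4442]

theorem sqrt_three_add_sqrt_five_lt : Real.sqrt (3 + Real.sqrt 5) < 2.3 := by
  have h : Real.sqrt 5 < 2.29 := by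
    rw [Real.sqrt_lt' (by norm_num)]
    norm_num
  rw [Real.sqrt_lt' (by norm_num)]
  linarith

theorem thmDoubleExt4442 :
    ∃ μ : ℝ, μ > Real.sqrt (3 + Real.sqrt 5) ∧
      ∃ v : Fin 12 → ℝ, v ≠ 0 ∧ (adjDoubleExt4442).mulVec v = μ • v := by
  obtain ⟨m, ⟨hm, -⟩, hroot⟩ := exists_root_charPolyDoubleExt4442
  refine ⟨m, sqrt_three_add_sqrt_five_lt.trans_le hm, eigenvectorDoubleExt4442 m, fun h => ?_,
    adjDoubleExt4442_mulVec_eigenvector hroot⟩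
  have hsq : (5 : ℝ) < m ^ 2 := by nlinarith
  have hpos : 0 < m * (m ^ 2 - 1) * (m ^ 2 - 5) :=
    mul_pos (mul_pos (by linarith) (by linarith)) (by linarith)
  exact hpos.ne' (congrFun h 0)
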